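/- Let δ > 0 and let p be a real number. Then limsup_{T → ∞} ∫_T^{T+δ} |ζ(1+it)|^p dt < ∞ if and only if −1 < p < 1. -/

import Mathlib

open Complex Real Filter MeasureTheory intervalIntegral

/-- `f` is an absolutely convergent trigonometric series whose coefficients are bounded in absolute
value by the (nonnegative) coefficients of the trigonometric series `F` with the same
frequencies. -/
def Majorized (f F : ℝ → ℂ) : Prop :=
  ∃ (ι : Type) (_ : Countable ι) (l : ι → ℝ) (c : ι → ℂ) (C : ι → ℝ),
    Summable C ∧ (∀ i, ‖c i‖ ≤ C i) ∧
    (∀ t : ℝ, HasSum (fun i => c i * cexp (l i * t * I)) (f t)) ∧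
    (∀ t : ℝ, HasSum (fun i => (C i : ℂ) * cexp (l i * t * I)) (F t))

namespace Majorized

variable {f g F G : ℝ → ℂ}

lemma norm_cexp_ofReal_mul_I (l t : ℝ) : ‖cexp (l * t * I)‖ = 1 := by
  rw [← ofReal_mul, norm_exp_ofReal_mul_I]

lemma monomial {c : ℂ} {C : ℝ} (h : ‖c‖ ≤ C) (l : ℝ) :
    Majorized (fun t => c * cexp (l * t * I)) (fun t => C * cexp (l * t * I)) :=
  ⟨Unit, inferInstance, fun _ => l, fun _ => c, fun _ => C, summable_of_hasFiniteSupport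
    (Set.toFinite _), fun _ => h, fun _ => hasSum_unique (fun _ : Unit => _),
    fun _ => hasSum_unique (fun _ : Unit => _)⟩

lemma norm_le (h : Majorized f F) (t : ℝ) : ‖f t‖ ≤ ‖F 0‖ := by
  obtain ⟨ι, _, l, c, C, hC, hcC, hf, hF⟩ := h
  have h0 : HasSum (fun i => (C i : ℂ)) (F 0) := by simpa using hF 0
  have h1 : F 0 = ((∑' i, C i : ℝ) : ℂ) := h0.unique (hasSum_ofReal.2 hC.hasSum)
  rw [h1, norm_real]
  refine le_trans ?_ (le_abs_self _)
  refine (hf t).norm_le_of_bounded hC.hasSum fun i => ?_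
  rw [norm_mul, norm_cexp_ofReal_mul_I, mul_one]
  exact hcC i

lemma mul (h : Majorized f F) (h' : Majorized g G) :
    Majorized (fun t => f t * g t) (fun t => F t * G t) := by
  obtain ⟨ι, _, l, c, C, hC, hcC, hf, hF⟩ := h
  obtain ⟨κ, _, m, d, D, hD, hdD, hg, hG⟩ := h'
  have hC0 i : 0 ≤ C i := (norm_nonneg _).trans (hcC i)
  have hD0 i : 0 ≤ D i := (norm_nonneg _).trans (hdD i)
  have key : ∀ (a : ι → ℂ) (b : κ → ℂ), (∀ i, ‖a i‖ ≤ C i) → (∀ i, ‖b i‖ ≤ D i) →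
      ∀ (x y : ℂ) (t : ℝ), HasSum (fun i => a i * cexp (l i * t * I)) x →
      HasSum (fun i => b i * cexp (m i * t * I)) y →
      HasSum (fun i : ι × κ => a i.1 * b i.2 * cexp ((l i.1 + m i.2 : ℝ) * t * I)) (x * y) := by
    intro a b ha hb x y t hx hy
    have hx' : Summable fun i => ‖a i * cexp (l i * t * I)‖ :=
      hC.of_nonneg_of_le (fun _ => norm_nonneg _)
        fun i => by simpa [norm_cexp_ofReal_mul_I] using ha i
    have hy' : Summable fun i => ‖b i * cexp (m i * t * I)‖ :=
      hD.of_nonneg_of_le (fun _ => norm_nonneg _)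
        fun i => by simpa [norm_cexp_ofReal_mul_I] using hb i
    have hsum : Summable fun i : ι × κ =>
        (a i.1 * cexp (l i.1 * t * I)) * (b i.2 * cexp (m i.2 * t * I)) :=
      summable_mul_of_summable_norm (f := fun i => a i * cexp (l i * t * I))
        (g := fun i => b i * cexp (m i * t * I)) hx' hy'
    have hxy := HasSum.mul hx hy hsum
    have heq : (fun i : ι × κ => a i.1 * b i.2 * cexp ((l i.1 + m i.2 : ℝ) * t * I)) =
        fun i => (a i.1 * cexp (l i.1 * t * I)) * (b i.2 * cexp (m i.2 * t * I)) := by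
      funext i
      push_cast
      rw [add_mul, add_mul, Complex.exp_add]
      ring
    rw [heq]
    exact hxy
  refine ⟨ι × κ, inferInstance, fun i => l i.1 + m i.2, fun i => c i.1 * d i.2,
    fun i => C i.1 * D i.2, hC.mul_of_nonneg hD hC0 hD0, fun i => ?_,
    fun t => key c d hcC hdD _ _ t (hf t) (hg t), fun t => ?_⟩
  · rw [norm_mul]
    exact mul_le_mul (hcC _) (hdD _) (norm_nonneg _) (hC0 _)
  · simpa using key (fun i => C i) (fun i => D i)
      (fun i => by simp [abs_of_nonneg (hC0 i)]) (fun i => by simp [abs_of_nonneg (hD0 i)])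
      _ _ t (hF t) (hG t)

lemma one : Majorized (fun _ => 1) (fun _ => 1) := by
  simpa using monomial (c := 1) (C := 1) (by simp) 0

lemma pow (h : Majorized f F) (n : ℕ) : Majorized (fun t => f t ^ n) (fun t => F t ^ n) := by
  induction n with
  | zero => simpa using one
  | succ n ih => simpa [pow_succ] using ih.mul h

lemma const_mul (h : Majorized f F) {a : ℂ} {A : ℝ} (ha : ‖a‖ ≤ A) :
    Majorized (fun t => a * f t) (fun t => A * F t) := by
  simpa using (monomial ha 0).mul h

lemma hasSum {κ : Type} [Countable κ] {f F : κ → ℝ → ℂ} {s S : ℝ → ℂ}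
    (h : ∀ k, Majorized (f k) (F k)) (h0 : Summable fun k => ‖F k 0‖)
    (hs : ∀ t, HasSum (fun k => f k t) (s t)) (hS : ∀ t, HasSum (fun k => F k t) (S t)) :
    Majorized s S := by
  choose ι hι l c C hC hcC hf hF using h
  have hC0 k i : 0 ≤ C k i := (norm_nonneg _).trans (hcC k i)
  have hCF k : ‖F k 0‖ = ∑' i, C k i := by
    have h0 : HasSum (fun i => (C k i : ℂ)) (F k 0) := by simpa using hF k 0
    have h1 : F k 0 = ((∑' i, C k i : ℝ) : ℂ) := h0.unique (hasSum_ofReal.2 (hC k).hasSum)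
    rw [h1, norm_real, Real.norm_of_nonneg (tsum_nonneg (hC0 k))]
  have hsum : Summable fun i : Σ k, ι k => C i.1 i.2 :=
    (summable_sigma_of_nonneg fun i => hC0 _ _).2 ⟨hC, by simpa [← hCF] using h0⟩
  have key : ∀ (a : ∀ k, ι k → ℂ), (∀ k i, ‖a k i‖ ≤ C k i) →
      ∀ (x : κ → ℂ) (y : ℂ) (t : ℝ),
      (∀ k, HasSum (fun i => a k i * cexp (l k i * t * I)) (x k)) → HasSum x y →
      HasSum (fun i : Σ k, ι k => a i.1 i.2 * cexp (l i.1 i.2 * t * I)) y := by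
    intro a ha x y t hx hy
    have h1 : Summable fun i : Σ k, ι k => a i.1 i.2 * cexp (l i.1 i.2 * t * I) :=
      Summable.of_norm_bounded hsum fun i => by
        simpa [norm_cexp_ofReal_mul_I] using ha i.1 i.2
    have h2 := h1.hasSum.sigma (fun k => hx k)
    rw [hy.unique h2]
    exact h1.hasSum
  exact ⟨Σ k, ι k, inferInstance, fun i => l i.1 i.2, fun i => c i.1 i.2, fun i => C i.1 i.2,
    hsum, fun i => hcC _ _, fun t => key c hcC _ _ t (fun k => hf k t) (hs t),
    fun t => key (fun k i => C k i) (fun k i => by simp [abs_of_nonneg (hC0 k i)])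
      _ _ t (fun k => hF k t) (hS t)⟩

lemma exp (h : Majorized f F) : Majorized (fun t => cexp (f t)) (fun t => cexp (F t)) := by
  have hexp (z : ℂ) : HasSum (fun n : ℕ => (((n.factorial : ℝ)⁻¹ : ℝ) : ℂ) * z ^ n) (cexp z) := by
    have := NormedSpace.exp_series_hasSum_exp' (𝕂 := ℂ) z
    simpa [Complex.exp_eq_exp_ℂ] using this
  refine hasSum (fun n => (h.pow n).const_mul
    (a := (((n.factorial : ℝ)⁻¹ : ℝ) : ℂ)) (A := (n.factorial : ℝ)⁻¹) (by simp)) ?_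
    (fun t => hexp _) (fun t => hexp _)
  simpa using (NormedSpace.norm_expSeries_summable' (𝕂 := ℂ) (F 0))

lemma conj (h : Majorized f F) :
    Majorized (fun t => starRingEnd ℂ (f t)) (fun t => starRingEnd ℂ (F t)) := by
  obtain ⟨ι, _, l, c, C, hC, hcC, hf, hF⟩ := h
  refine ⟨ι, inferInstance, fun i => - l i, fun i => starRingEnd ℂ (c i), C, hC, by simpa using hcC,
    fun t => ?_, fun t => ?_⟩
  · simpa [← Complex.exp_conj] using (hasSum_conj'.2 (hf t))
  · simpa [← Complex.exp_conj] using (hasSum_conj'.2 (hF t))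

lemma comp_add_left (h : Majorized f F) (T : ℝ) : Majorized (fun t => f (T + t)) F := by
  obtain ⟨ι, _, l, c, C, hC, hcC, hf, hF⟩ := h
  refine ⟨ι, inferInstance, l, fun i => c i * cexp (l i * T * I), C, hC,
    by simpa [norm_cexp_ofReal_mul_I] using hcC, fun t => ?_, hF⟩
  convert hf (T + t) using 1
  funext i
  push_cast
  rw [mul_add, add_mul, Complex.exp_add]
  ring

lemma continuous (h : Majorized f F) : Continuous f := by
  obtain ⟨ι, _, l, c, C, hC, hcC, hf, hF⟩ := h
  have : f = fun t : ℝ => ∑' i, c i * cexp (l i * t * I) := funext fun t => (hf t).tsum_eq.symm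
  rw [this]
  exact continuous_tsum (fun i => by fun_prop) hC fun i t => by
    simpa [norm_cexp_ofReal_mul_I] using hcC i


lemma re_double_integral_le (h : Majorized f F) {d : ℝ} (hd : 0 ≤ d) :
    (∫ x in (0 : ℝ)..d, ∫ y in (0 : ℝ)..d, f (x - y)).re ≤
      (∫ x in (0 : ℝ)..d, ∫ y in (0 : ℝ)..d, F (x - y)).re := by
  obtain ⟨ι, _, l, c, C, hC, hcC, hf, hF⟩ := h
  have hC0 i : 0 ≤ C i := (norm_nonneg _).trans (hcC i)
  let J : ι → ℝ := fun i => ‖∫ x in (0 : ℝ)..d, cexp (l i * x * I)‖ ^ 2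
  have hJ i : (J i : ℂ) = (∫ x in (0 : ℝ)..d, cexp (l i * x * I)) *
      ∫ x in (0 : ℝ)..d, cexp (- (l i * x * I)) := by
    have : (∫ x in (0 : ℝ)..d, cexp (- (l i * x * I))) =
        starRingEnd ℂ (∫ x in (0 : ℝ)..d, cexp (l i * x * I)) := by
      rw [← intervalIntegral_conj]
      congr 1
      ext x
      simp [← Complex.exp_conj]
    rw [this, Complex.mul_conj, Complex.normSq_eq_norm_sq]
  have key : ∀ (a : ι → ℂ), (∀ i, ‖a i‖ ≤ C i) → ∀ g : ℝ → ℂ,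
      (∀ t : ℝ, HasSum (fun i => a i * cexp (l i * t * I)) (g t)) →
      HasSum (fun i => a i * J i) (∫ x in (0 : ℝ)..d, ∫ y in (0 : ℝ)..d, g (x - y)) := by
    intro a ha g hg
    have hin (x : ℝ) : HasSum (fun i => ∫ y in (0 : ℝ)..d, a i * cexp (l i * (x - y : ℝ) * I))
        (∫ y in (0 : ℝ)..d, g (x - y)) := by
      refine intervalIntegral.hasSum_integral_of_dominated_convergence (fun i _ => C i)
        (fun i => (by fun_prop : Continuous _).aestronglyMeasurable)
        (fun i => .of_forall fun y _ => ?_) (.of_forall fun _ _ => hC) (by simp)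
        (.of_forall fun y _ => hg _)
      rw [norm_mul, norm_cexp_ofReal_mul_I, mul_one]
      exact ha i
    have hval i (x : ℝ) : ∫ y in (0 : ℝ)..d, a i * cexp (l i * (x - y : ℝ) * I) =
        a i * (cexp (l i * x * I) * ∫ y in (0 : ℝ)..d, cexp (- (l i * y * I))) := by
      rw [← intervalIntegral.integral_const_mul, ← intervalIntegral.integral_const_mul]
      congr 1
      ext y
      rw [← Complex.exp_add]
      push_cast
      ring_nf
    have hout := intervalIntegral.hasSum_integral_of_dominated_convergence (μ := volume)
      (a := 0) (b := d)
      (F := fun i x => ∫ y in (0 : ℝ)..d, a i * cexp (l i * (x - y : ℝ) * I))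
      (f := fun x => ∫ y in (0 : ℝ)..d, g (x - y)) (fun i _ => C i * d)
      (fun i => by
        simp only [hval]
        exact (by fun_prop : Continuous _).aestronglyMeasurable)
      (fun i => .of_forall fun x _ => by
        refine (intervalIntegral.norm_integral_le_of_norm_le_const (C := C i) fun y _ => ?_).trans
          (by simp [abs_of_nonneg hd])
        rw [norm_mul, norm_cexp_ofReal_mul_I, mul_one]
        exact ha i)
      (.of_forall fun _ _ => hC.mul_right d) (by simp) (.of_forall fun x _ => hin x)
    have heq : (fun i => a i * (J i : ℂ)) = fun i => ∫ x in (0 : ℝ)..d, ∫ y in (0 : ℝ)..d,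
        a i * cexp (l i * (x - y : ℝ) * I) := by
      funext i
      simp only [hval]
      rw [hJ, ← intervalIntegral.integral_mul_const, ← intervalIntegral.integral_const_mul]
    rw [heq]
    exact hout
  have h1 := Complex.hasSum_re (key c hcC f hf)
  have h2 := Complex.hasSum_re (key (fun i => C i) (fun i => by simp [abs_of_nonneg (hC0 i)]) F hF)
  refine hasSum_le (fun i => ?_) h1 h2
  rw [Complex.re_mul_ofReal, Complex.re_mul_ofReal, ofReal_re]
  exact mul_le_mul_of_nonneg_right ((re_le_norm _).trans (hcC i)) (by positivity)

lemma right_self (h : Majorized f F) : Majorized F F := by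
  obtain ⟨ι, hι, l, c, C, hC, hcC, hf, hF⟩ := h
  have hC0 i : 0 ≤ C i := (norm_nonneg _).trans (hcC i)
  exact ⟨ι, hι, l, fun i => C i, C, hC, fun i => by simp [abs_of_nonneg (hC0 i)], hF, hF⟩

lemma integral_norm_sq_le (h : Majorized f F) {d : ℝ} (hd : 0 < d) :
    ∫ t in (0 : ℝ)..d, ‖f t‖ ^ 2 ≤ 2 * ∫ t in (-(2 * d))..(2 * d), ‖F t‖ ^ 2 := by
  have hre (g : ℝ → ℂ) :
      (∫ x in (0 : ℝ)..(2 * d), ∫ y in (0 : ℝ)..(2 * d),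
        g (x - y) * starRingEnd ℂ (g (x - y))).re =
      ∫ x in (0 : ℝ)..(2 * d), ∫ y in (0 : ℝ)..(2 * d), ‖g (x - y)‖ ^ 2 := by
    simp only [Complex.mul_conj, Complex.normSq_eq_norm_sq, intervalIntegral.integral_ofReal,
      ofReal_re]
  have hmain := (h.mul h.conj).re_double_integral_le (d := 2 * d) (by positivity)
  rw [hre f, hre F] at hmain
  have hsub (g : ℝ → ℂ) (x : ℝ) : ∫ y in (0 : ℝ)..(2 * d), ‖g (x - y)‖ ^ 2 =
      ∫ y in (x - 2 * d)..x, ‖g y‖ ^ 2 := by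
    simpa using intervalIntegral.integral_comp_sub_left (a := 0) (b := 2 * d)
      (fun y => ‖g y‖ ^ 2) x
  have hcont {g : ℝ → ℂ} (hg : Continuous g) :
      Continuous fun x => ∫ y in (0 : ℝ)..(2 * d), ‖g (x - y)‖ ^ 2 :=
    intervalIntegral.continuous_parametric_intervalIntegral_of_continuous' (by fun_prop) _ _
  have hf := h.continuous
  have hF := h.right_self.continuous
  have hlow : ∫ x in d..(2 * d), (∫ t in (0 : ℝ)..d, ‖f t‖ ^ 2) ≤
      ∫ x in d..(2 * d), ∫ y in (0 : ℝ)..(2 * d), ‖f (x - y)‖ ^ 2 := by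
    refine intervalIntegral.integral_mono_on (by linarith) (by simp)
      ((hcont hf).intervalIntegrable _ _) fun x hx => ?_
    rw [hsub]
    exact intervalIntegral.integral_mono_interval (by linarith [hx.2]) hd.le hx.1
      (.of_forall fun _ => by positivity) ((by fun_prop : Continuous _).intervalIntegrable _ _)
  have hmid : ∫ x in d..(2 * d), ∫ y in (0 : ℝ)..(2 * d), ‖f (x - y)‖ ^ 2 ≤
      ∫ x in (0 : ℝ)..(2 * d), ∫ y in (0 : ℝ)..(2 * d), ‖f (x - y)‖ ^ 2 :=
    intervalIntegral.integral_mono_interval hd.le (by linarith) le_rfl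
      (.of_forall fun x => intervalIntegral.integral_nonneg (by positivity)
        fun _ _ => by positivity) ((hcont hf).intervalIntegrable _ _)
  have hup : ∫ x in (0 : ℝ)..(2 * d), ∫ y in (0 : ℝ)..(2 * d), ‖F (x - y)‖ ^ 2 ≤
      ∫ x in (0 : ℝ)..(2 * d), (∫ t in (-(2 * d))..(2 * d), ‖F t‖ ^ 2) := by
    refine intervalIntegral.integral_mono_on (by linarith)
      ((hcont hF).intervalIntegrable _ _) (by simp) fun x hx => ?_
    rw [hsub]
    exact intervalIntegral.integral_mono_interval (by linarith [hx.1]) (by linarith) hx.2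
      (.of_forall fun _ => by positivity) ((by fun_prop : Continuous _).intervalIntegrable _ _)
  have hall := (hlow.trans hmid).trans (hmain.trans hup)
  simp only [intervalIntegral.integral_const, smul_eq_mul] at hall
  refine le_of_mul_le_mul_left ?_ hd
  linarith

end Majorized

lemma summable_primes_rpow_neg {σ : ℝ} (hσ : 1 < σ) :
    Summable fun p : Nat.Primes => (p : ℝ) ^ (-σ) :=
  Nat.Primes.summable_rpow.2 (by linarith)

lemma prime_cpow_neg (p : Nat.Primes) (σ t : ℝ) :
    (p : ℂ) ^ (-(σ + t * I)) = ((p : ℝ) ^ (-σ) : ℝ) * cexp ((-Real.log p : ℝ) * t * I) := by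
  have hp : (0 : ℝ) < p := by exact_mod_cast p.prop.pos
  have hp' : (p : ℂ) ≠ 0 := by exact_mod_cast p.prop.ne_zero
  rw [ofReal_cpow hp.le, ofReal_natCast, cpow_def_of_ne_zero hp', cpow_def_of_ne_zero hp',
    ← Complex.exp_add, ofReal_neg, ofReal_neg, ← Complex.ofReal_natCast, ← ofReal_log hp.le]
  congr 1
  ring

lemma prime_rpow_neg_le_half (p : Nat.Primes) {σ : ℝ} (hσ : 1 < σ) : (p : ℝ) ^ (-σ) ≤ 1 / 2 := by
  have hp : (2 : ℝ) ≤ p := by exact_mod_cast p.prop.two_le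
  calc (p : ℝ) ^ (-σ) ≤ (p : ℝ) ^ (-1 : ℝ) :=
        Real.rpow_le_rpow_of_exponent_le (by linarith) (by linarith)
    _ ≤ 1 / 2 := by
        rw [Real.rpow_neg_one, ← one_div]
        exact one_div_le_one_div_of_le (by norm_num) hp

lemma norm_log_one_sub_le {z : ℂ} (hz : ‖z‖ ≤ 1 / 2) :
    ‖-Complex.log (1 - z)‖ ≤ 3 / 2 * ‖z‖ := by
  rw [norm_neg, sub_eq_add_neg]
  simpa using Complex.norm_log_one_add_half_le_self (z := -z) (by simpa using hz)

lemma norm_prime_cpow_neg (p : Nat.Primes) (s : ℂ) : ‖(p : ℂ) ^ (-s)‖ = (p : ℝ) ^ (-s.re) := by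
  simpa using norm_natCast_cpow_of_pos p.prop.pos (-s)

/-- The logarithm of the Riemann zeta function defined by the Euler product. -/
noncomputable def logEulerZeta (s : ℂ) : ℂ := ∑' p : Nat.Primes, -Complex.log (1 - (p : ℂ) ^ (-s))

lemma exp_logEulerZeta {s : ℂ} (hs : 1 < s.re) : cexp (logEulerZeta s) = riemannZeta s :=
  riemannZeta_eulerProduct_exp_log hs

lemma summable_logEulerZeta {s : ℂ} (hs : 1 < s.re) :
    Summable fun p : Nat.Primes => -Complex.log (1 - (p : ℂ) ^ (-s)) := by
  refine Summable.of_norm_bounded ((summable_primes_rpow_neg hs).mul_left (3 / 2)) fun p => ?_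
  rw [← norm_prime_cpow_neg]
  exact norm_log_one_sub_le ((norm_prime_cpow_neg p s).trans_le (prime_rpow_neg_le_half p hs))

lemma majorized_mul_logEulerZeta {σ : ℝ} (hσ : 1 < σ) {c : ℂ} {q : ℝ} (hc : ‖c‖ ≤ q) :
    Majorized (fun t => c * logEulerZeta (σ + t * I)) (fun t => q * logEulerZeta (σ + t * I)) := by
  have hre (t : ℝ) : 1 < ((σ : ℂ) + t * I).re := by simpa using hσ
  have hprime (p : Nat.Primes) : Majorized (fun t => -Complex.log (1 - (p : ℂ) ^ (-(σ + t * I))))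
      (fun t => -Complex.log (1 - (p : ℂ) ^ (-(σ + t * I)))) := by
    set r : ℝ := (p : ℝ) ^ (-σ) with hr
    have hr0 : 0 ≤ r := by positivity
    have hr1 : r ≤ 1 / 2 := prime_rpow_neg_le_half p hσ
    have hmon := Majorized.monomial (c := (r : ℂ)) (C := r) (by simp [abs_of_nonneg hr0])
      (-Real.log p)
    have hlog (t : ℝ) := Complex.hasSum_taylorSeries_neg_log (z := (p : ℂ) ^ (-(σ + t * I))) (by
      rw [norm_prime_cpow_neg]
      simpa using hr1.trans_lt (by norm_num))
    refine Majorized.hasSum (fun n : ℕ => (hmon.pow n).const_mul (a := ((1 / n : ℝ) : ℂ))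
      (A := 1 / n) (by simp)) ?_ (fun t => ?_) (fun t => ?_)
    · refine (summable_geometric_of_lt_one hr0 (hr1.trans_lt (by norm_num))).of_nonneg_of_le
        (fun _ => norm_nonneg _) fun n => ?_
      simp only [ofReal_zero, mul_zero, zero_mul, Complex.exp_zero, mul_one, norm_mul, norm_pow,
        norm_real, Real.norm_of_nonneg hr0]
      refine mul_le_of_le_one_left (by positivity) ?_
      rw [Real.norm_of_nonneg (by positivity)]
      rcases Nat.eq_zero_or_pos n with rfl | hn
      · simp
      · exact (div_le_one (by positivity)).2 (by exact_mod_cast hn)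
    all_goals
      convert hlog t using 2 with n
      rw [prime_cpow_neg, ← hr]
      push_cast
      ring
  refine Majorized.const_mul (Majorized.hasSum hprime ?_
    (fun t => (summable_logEulerZeta (hre t)).hasSum)
    (fun t => (summable_logEulerZeta (hre t)).hasSum)) hc
  simpa using (summable_logEulerZeta (hre 0)).norm

lemma norm_zeta_rpow_eq {s : ℂ} (hs : 1 < s.re) (p : ℝ) :
    ‖riemannZeta s‖ ^ p = ‖cexp ((p / 2 : ℝ) * logEulerZeta s)‖ ^ 2 := by
  rw [← exp_logEulerZeta hs, Complex.norm_exp, Complex.norm_exp, ← Real.exp_mul, ← Real.exp_nat_mul,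
    re_ofReal_mul]
  congr 1
  push_cast
  ring

lemma exists_residue_bounds (R : ℝ) : ∃ c > 0, ∃ C, ∀ s : ℂ, 1 ≤ s.re → s.re ≤ 2 →
    |s.im| ≤ R → s ≠ 1 → c ≤ ‖s - 1‖ * ‖riemannZeta s‖ ∧ ‖s - 1‖ * ‖riemannZeta s‖ ≤ C := by
  let g : ℂ → ℂ := Function.update (fun s => (s - 1) * riemannZeta s) 1 1
  have hg : Continuous g := by
    refine continuous_iff_continuousAt.2 fun s => ?_
    rcases eq_or_ne s 1 with rfl | hs
    · exact continuousAt_update_same.2 riemannZeta_residue_one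
    · refine (continuousAt_update_of_ne hs).2 ?_
      exact (by fun_prop : ContinuousAt (fun s : ℂ => s - 1) s).mul
        (differentiableAt_riemannZeta hs).continuousAt
  have hgne s (hs : 1 ≤ s.re) : g s ≠ 0 := by
    rcases eq_or_ne s 1 with rfl | h
    · simp [g]
    · simp only [g, Function.update_of_ne h]
      exact mul_ne_zero (sub_ne_zero.2 h) (riemannZeta_ne_zero_of_one_le_re hs)
  have hK : IsCompact (Set.Icc (1 : ℝ) 2 ×ℂ Set.Icc (-R) R) := isCompact_Icc.reProdIm isCompact_Icc
  obtain ⟨C, hC⟩ := hK.exists_bound_of_continuousOn hg.continuousOn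
  obtain ⟨D, hD⟩ := hK.exists_bound_of_continuousOn (f := fun s => (g s)⁻¹)
    (hg.continuousOn.inv₀ fun s hs => hgne s hs.1.1)
  refine ⟨(max D 1)⁻¹, by positivity, C, fun s h1 h2 h3 hs => ?_⟩
  have hmem : s ∈ Set.Icc (1 : ℝ) 2 ×ℂ Set.Icc (-R) R := ⟨⟨h1, h2⟩, abs_le.1 h3⟩
  have hgs : ‖g s‖ = ‖s - 1‖ * ‖riemannZeta s‖ := by simp [g, Function.update_of_ne hs]
  rw [← hgs]
  refine ⟨?_, hC s hmem⟩
  have := hD s hmem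
  rw [norm_inv] at this
  exact inv_le_of_inv_le₀ (norm_pos_iff.2 (hgne s h1)) (this.trans (le_max_left _ _))

lemma intervalIntegrable_abs_rpow {r : ℝ} (hr : -1 < r) (a : ℝ) :
    IntervalIntegrable (fun t : ℝ => |t| ^ r) volume (-a) a := by
  have h (a : ℝ) (ha : 0 ≤ a) : IntervalIntegrable (fun t : ℝ => |t| ^ r) volume 0 a := by
    refine (intervalIntegral.intervalIntegrable_rpow' (a := 0) (b := a) hr).congr fun t ht => ?_
    rw [Set.uIoc_of_le ha] at ht
    simp [abs_of_pos ht.1]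
  have h' (a : ℝ) : IntervalIntegrable (fun t : ℝ => |t| ^ r) volume 0 a := by
    rcases le_total 0 a with ha | ha
    · exact h a ha
    · simpa using (IntervalIntegrable.iff_comp_neg (a := 0) (b := -a)).1 (h (-a) (by linarith))
  exact (h' (-a)).symm.trans (h' a)

lemma exists_integral_zeta_rpow_le {p : ℝ} (h1 : -1 < p) (h2 : p < 1) {δ : ℝ} (hδ : 0 < δ) :
    ∃ B, ∀ σ : ℝ, 1 < σ → σ ≤ 2 → ∀ T : ℝ,
      ∫ t in (0 : ℝ)..δ, ‖riemannZeta (σ + (T + t : ℝ) * I)‖ ^ p ≤ B := by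
  obtain ⟨c, -, C, hC⟩ := exists_residue_bounds (2 * δ)
  refine ⟨2 * ∫ t in (-(2 * δ))..(2 * δ), C ^ |p| * |t| ^ (-|p|), fun σ hσ hσ2 T => ?_⟩
  have hre (t : ℝ) : 1 < ((σ : ℂ) + t * I).re := by simpa using hσ
  have hne (t : ℝ) : (σ : ℂ) + t * I ≠ 1 := fun h => by
    have := hre t
    rw [h] at this
    simp at this
  have hM := (majorized_mul_logEulerZeta hσ (c := ((p / 2 : ℝ) : ℂ)) (q := |p| / 2)
    (by simp)).exp
  have hle := (hM.comp_add_left T).integral_norm_sq_le hδ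
  simp only [← norm_zeta_rpow_eq (hre _)] at hle
  refine hle.trans (mul_le_mul_of_nonneg_left ?_ zero_le_two)
  have hcont : Continuous fun t : ℝ => ‖riemannZeta (σ + t * I)‖ ^ |p| := by
    simp only [norm_zeta_rpow_eq (hre _)]
    exact hM.right_self.continuous.norm.pow 2
  refine intervalIntegral.integral_mono_ae_restrict (by linarith) (hcont.intervalIntegrable _ _)
    ((intervalIntegrable_abs_rpow (by linarith [abs_lt.2 ⟨h1, h2⟩]) _).const_mul _) ?_
  filter_upwards [ae_restrict_mem measurableSet_Icc,
    ae_restrict_of_ae (compl_mem_ae_iff.2 (measure_singleton (0 : ℝ)))] with t ht ht0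
  have ht0 : 0 < |t| := abs_pos.2 ht0
  have hbd := (hC (σ + t * I) (hre t).le (by simpa using hσ2) (by simpa using abs_le.2 ht)
    (hne t)).2
  have htle : |t| ≤ ‖(σ : ℂ) + t * I - 1‖ := by
    simpa using abs_im_le_norm ((σ : ℂ) + t * I - 1)
  have hC0 : 0 ≤ C := le_trans (by positivity) hbd
  calc ‖riemannZeta (σ + t * I)‖ ^ |p| ≤ (C / |t|) ^ |p| := by
        refine Real.rpow_le_rpow (norm_nonneg _) ((le_div_iff₀ ht0).2 ?_) (abs_nonneg p)
        rw [mul_comm]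
        exact (mul_le_mul_of_nonneg_right htle (norm_nonneg _)).trans hbd
    _ = C ^ |p| * |t| ^ (-|p|) := by
        rw [Real.div_rpow hC0 ht0.le, Real.rpow_neg ht0.le, div_eq_mul_inv]

lemma zeta_ne_zero_and_continuous_clamp :
    (∀ σ t : ℝ, riemannZeta ((max σ 1 : ℝ) + (max t 1 : ℝ) * I) ≠ 0) ∧
    Continuous fun x : ℝ × ℝ => riemannZeta ((max x.1 1 : ℝ) + (max x.2 1 : ℝ) * I) := by
  refine ⟨fun σ t => riemannZeta_ne_zero_of_one_le_re (by simp), ?_⟩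
  refine continuous_iff_continuousAt.2 fun x => ?_
  have hne : ((max x.1 1 : ℝ) + (max x.2 1 : ℝ) * I : ℂ) ≠ 1 := fun h => by
    have := congrArg Complex.im h
    simp only [add_im, ofReal_im, mul_im, ofReal_re, I_im, I_re, one_im] at this
    linarith [le_max_right x.2 1]
  exact (differentiableAt_riemannZeta hne).continuousAt.comp
    (f := fun x : ℝ × ℝ => ((max x.1 1 : ℝ) + (max x.2 1 : ℝ) * I : ℂ))
    (by fun_prop : Continuous _).continuousAt

lemma exists_integral_zeta_one_rpow_le {p : ℝ} (h1 : -1 < p) (h2 : p < 1) {δ : ℝ} (hδ : 0 < δ) :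
    ∃ B, ∀ T : ℝ, 1 ≤ T → ∫ t in T..(T + δ), ‖riemannZeta (1 + t * I)‖ ^ p ≤ B := by
  obtain ⟨B, hB⟩ := exists_integral_zeta_rpow_le h1 h2 hδ
  refine ⟨B, fun T hT => ?_⟩
  obtain ⟨hne, hcont⟩ := zeta_ne_zero_and_continuous_clamp
  let Φ : ℝ → ℝ := fun σ =>
    ∫ t in T..(T + δ), ‖riemannZeta ((max σ 1 : ℝ) + (max t 1 : ℝ) * I)‖ ^ p
  have hΦ : Continuous Φ :=
    intervalIntegral.continuous_parametric_intervalIntegral_of_continuous'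
      (hcont.norm.rpow_const fun x => Or.inl (norm_ne_zero_iff.2 (hne _ _))) _ _
  have hval (σ : ℝ) (hσ : 1 ≤ σ) : Φ σ = ∫ t in T..(T + δ), ‖riemannZeta (σ + t * I)‖ ^ p := by
    refine intervalIntegral.integral_congr fun t ht => ?_
    rw [Set.uIcc_of_le (by linarith)] at ht
    simp only [max_eq_left hσ, max_eq_left (hT.trans ht.1)]
  have hlim : Tendsto Φ (nhdsWithin 1 (Set.Ioi 1)) (nhds (Φ 1)) :=
    hΦ.continuousAt.tendsto.mono_left nhdsWithin_le_nhds
  have hone := hval 1 le_rfl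
  rw [ofReal_one] at hone
  rw [← hone]
  refine le_of_tendsto hlim ?_
  filter_upwards [Ioo_mem_nhdsGT (one_lt_two (α := ℝ))] with σ hσ
  rw [hval σ hσ.1.le]
  have := hB σ hσ.1 hσ.2.le T
  simpa using (intervalIntegral.integral_comp_add_left (a := 0) (b := δ)
    (fun t : ℝ => ‖riemannZeta (σ + t * I)‖ ^ p) T).symm.trans_le this

lemma differentiableAt_integral_add_mul_I {f : ℂ → ℂ} {W : Set ℂ} (hW : IsOpen W)
    (hf : DifferentiableOn ℂ f W) (hfc : Continuous f) {φ : ℝ → ℂ} (hφ : Continuous φ)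
    (hφ1 : ∀ u, ‖φ u‖ ≤ 1) {δ : ℝ} (hδ : 0 ≤ δ)
    (hWadd : ∀ s ∈ W, ∀ u ∈ Set.Icc 0 δ, s + u * I ∈ W) {z : ℂ} (hz : z ∈ W) :
    DifferentiableAt ℂ (fun s => ∫ u in (0 : ℝ)..δ, f (s + u * I) * φ u) z := by
  obtain ⟨r, hr, hrW⟩ := Metric.nhds_basis_closedBall.mem_iff.1 (hW.mem_nhds hz)
  have hK : IsCompact ((fun x : ℂ × ℝ => x.1 + x.2 * I) ''
      (Metric.closedBall z r ×ˢ Set.Icc 0 δ)) :=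
    ((isCompact_closedBall z r).prod isCompact_Icc).image (by fun_prop)
  obtain ⟨M, hM⟩ := hK.exists_bound_of_continuousOn (f := deriv f)
    ((hf.deriv hW).continuousOn.mono (by
      rintro _ ⟨⟨s, u⟩, ⟨hs, hu⟩, rfl⟩
      exact hWadd s (hrW hs) u hu))
  refine (intervalIntegral.hasDerivAt_integral_of_dominated_loc_of_deriv_le (μ := volume)
    (F' := fun s u => deriv f (s + u * I) * φ u) (bound := fun _ => M)
    (Metric.closedBall_mem_nhds z hr) (.of_forall fun s => ?_) ?_ ?_
    (.of_forall fun u hu s hs => ?_) (by simp) (.of_forall fun u hu s hs => ?_)).2.differentiableAt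
  · exact (by fun_prop : Continuous fun u : ℝ => f (s + u * I) * φ u).aestronglyMeasurable
  · exact (by fun_prop : Continuous fun u : ℝ => f (z + u * I) * φ u).intervalIntegrable _ _
  · exact (((measurable_deriv f).comp (by fun_prop : Measurable fun u : ℝ => z + u * I)).mul
      hφ.measurable).aestronglyMeasurable
  · rw [Set.uIoc_of_le hδ] at hu
    have := hM _ ⟨(s, u), ⟨hs, Set.Ioc_subset_Icc_self hu⟩, rfl⟩
    rw [norm_mul]
    exact (mul_le_of_le_one_right (norm_nonneg _) (hφ1 u)).trans this
  · rw [Set.uIoc_of_le hδ] at hu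
    have hmem := hWadd s (hrW hs) u (Set.Ioc_subset_Icc_self hu)
    have h1 := (hf.differentiableAt (hW.mem_nhds hmem)).hasDerivAt
    exact (h1.comp_add_const s (u * I)).mul_const _

/-- A function on a half-strip which is bounded on the left, bottom and right sides and is
`O(1 / (re s - 1))` is bounded. -/
lemma norm_le_of_half_strip {G : ℂ → ℂ} {T₀ C : ℝ} (hG : Continuous G)
    (hd : ∀ s : ℂ, 1 < s.re → T₀ < s.im → DifferentiableAt ℂ G s)
    (hleft : ∀ s : ℂ, s.re = 1 → T₀ ≤ s.im → ‖G s‖ ≤ C)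
    (hbot : ∀ s : ℂ, 1 ≤ s.re → s.re ≤ 2 → s.im = T₀ → ‖G s‖ ≤ C)
    (hb : ∀ s : ℂ, 1 < s.re → s.re ≤ 2 → T₀ ≤ s.im → ‖G s‖ * (s.re - 1) ≤ C)
    {z : ℂ} (hz1 : 1 < z.re) (hz2 : z.re < 2) (hz3 : T₀ < z.im) : ‖G z‖ ≤ C := by
  have hC : 0 ≤ C := (norm_nonneg _).trans (hleft ⟨1, T₀⟩ rfl le_rfl)
  have key (X : ℝ) (hX : z.im < X) :
      ‖G z‖ * ‖z - 1 - X * I‖ ≤ C * (‖z - 1 - X * I‖ + 1) := by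
    let U := Set.Ioo (1 : ℝ) 2 ×ℂ Set.Ioo T₀ X
    have hTX : T₀ < X := hz3.trans hX
    have hcl : closure U = Set.Icc (1 : ℝ) 2 ×ℂ Set.Icc T₀ X := by
      rw [closure_reProdIm, closure_Ioo one_lt_two.ne, closure_Ioo hTX.ne]
    have hne (s : ℂ) (hs : 1 ≤ s.re) : s - 1 - X * I + 1 ≠ 0 := fun h => by
      have := congrArg Complex.re h
      simp at this
      linarith
    have hle (s : ℂ) (hs : 1 ≤ s.re) : ‖s - 1 - X * I‖ ≤ ‖s - 1 - X * I + 1‖ := by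
      rw [← sq_le_sq₀ (norm_nonneg _) (norm_nonneg _), ← Complex.normSq_eq_norm_sq,
        ← Complex.normSq_eq_norm_sq, Complex.normSq_apply, Complex.normSq_apply]
      simp
      nlinarith
    have hfac (s : ℂ) (hs : 1 ≤ s.re) : ‖(s - 1 - X * I) / (s - 1 - X * I + 1)‖ ≤ 1 := by
      rw [norm_div]
      exact div_le_one_of_le₀ (hle s hs) (norm_nonneg _)
    let H : ℂ → ℂ := fun s => G s * ((s - 1 - X * I) / (s - 1 - X * I + 1))
    have hfr : ∀ s ∈ frontier U, ‖H s‖ ≤ C := by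
      intro s hs
      have hscl : s ∈ Set.Icc (1 : ℝ) 2 ×ℂ Set.Icc T₀ X := hcl ▸ frontier_subset_closure hs
      obtain ⟨⟨hs1, hs2⟩, hs3, hs4⟩ := hscl
      have hof (h : ‖G s‖ ≤ C) : ‖H s‖ ≤ C := by
        rw [norm_mul]
        exact (mul_le_of_le_one_right (norm_nonneg _) (hfac s hs1)).trans h
      rw [frontier_reProdIm, frontier_Ioo one_lt_two, frontier_Ioo hTX] at hs
      rcases hs with ⟨-, h⟩ | ⟨h, -⟩
      · rcases h with h | h
        · exact hof (hbot s hs1 hs2 h)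
        · rcases hs1.eq_or_lt with h1 | h1
          · exact hof (hleft s h1.symm hs3)
          · have hw : s - 1 - X * I = ((s.re - 1 : ℝ) : ℂ) := by
              apply Complex.ext
              · simp
              · simpa using sub_eq_zero.2 h
            have hw' : s - 1 - X * I + 1 = ((s.re : ℝ) : ℂ) := by
              rw [hw]
              push_cast
              ring
            refine le_trans ?_ (hb s h1 hs2 hs3)
            rw [norm_mul, hw', hw, norm_div, norm_real, norm_real,
              Real.norm_of_nonneg (by linarith), Real.norm_of_nonneg (by linarith)]
            exact mul_le_mul_of_nonneg_left (div_le_self (by linarith) hs1) (norm_nonneg _)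
      · rcases h with h | h
        · exact hof (hleft s h hs3)
        · have := hb s (by rw [h]; norm_num) hs2 hs3
          rw [h] at this
          exact hof (by linarith)
    have hdc : DiffContOnCl ℂ H U := by
      refine ⟨fun s hs => ?_, fun s hs => ?_⟩
      · have h1 := hd s hs.1.1 hs.2.1
        have h2 := hne s hs.1.1.le
        exact (h1.mul (by fun_prop (disch := exact h2))).differentiableWithinAt
      · rw [hcl] at hs
        have h2 := hne s hs.1.1
        exact (hG.continuousAt.mul (by fun_prop (disch := exact h2))).continuousWithinAt
    have hb : Bornology.IsBounded U :=
      (isCompact_Icc.reProdIm isCompact_Icc).isBounded.subset (hcl ▸ subset_closure)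
    have := Complex.norm_le_of_forall_mem_frontier_norm_le hb hdc hfr
      (subset_closure (⟨⟨hz1, hz2⟩, hz3, hX⟩ : z ∈ U))
    rw [norm_mul, norm_div, ← mul_div_assoc, div_le_iff₀ (norm_pos_iff.2 (hne z hz1.le))] at this
    exact this.trans (mul_le_mul_of_nonneg_left
      ((norm_add_le _ _).trans (by simp)) hC)
  by_contra! hlt
  have hpos : 0 < ‖G z‖ - C := sub_pos.2 hlt
  have hk := key (z.im + C / (‖G z‖ - C) + 1) (by
    have : 0 ≤ C / (‖G z‖ - C) := by positivity
    linarith)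
  set w := z - 1 - (z.im + C / (‖G z‖ - C) + 1 : ℝ) * I with hw
  have hwn : C / (‖G z‖ - C) + 1 ≤ ‖w‖ := by
    have him : w.im = -(C / (‖G z‖ - C) + 1) := by
      rw [hw]
      simp only [sub_im, mul_im, ofReal_re, ofReal_im, I_re, I_im, one_im]
      ring
    exact le_trans (by rw [him, neg_neg]) (le_trans (neg_le_abs _) (abs_im_le_norm w))
  have h1 : C < ‖w‖ * (‖G z‖ - C) := (div_lt_iff₀ hpos).1 (by linarith)
  nlinarith

lemma exists_integral_norm_le_of_line {f : ℂ → ℂ} {δ T₀ C₁ C₂ : ℝ} (hδ : 0 < δ)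
    (hd : ∀ s : ℂ, 1 ≤ s.re → T₀ ≤ s.im → DifferentiableAt ℂ f s)
    (hne : ∀ s : ℂ, 1 ≤ s.re → T₀ ≤ s.im → f s ≠ 0)
    (hb : ∀ s : ℂ, 1 < s.re → s.re ≤ 2 → T₀ ≤ s.im → ‖f s‖ * (s.re - 1) ≤ C₁)
    (hl : ∀ T, T₀ ≤ T → ∫ t in T..(T + δ), ‖f (1 + t * I)‖ ≤ C₂) :
    ∃ C, ∀ σ : ℝ, 1 < σ → σ < 2 → ∀ T, T₀ < T →
      ∫ t in (0 : ℝ)..δ, ‖f (σ + (T + t : ℝ) * I)‖ ≤ C := by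
  obtain ⟨M, hM⟩ := (isCompact_Icc.reProdIm isCompact_Icc :
    IsCompact (Set.Icc (1 : ℝ) 2 ×ℂ Set.Icc T₀ (T₀ + δ))).exists_bound_of_continuousOn (f := f)
      fun s hs => (hd s hs.1.1 hs.2.1).continuousAt.continuousWithinAt
  refine ⟨max (max (C₁ * δ) C₂) (M * δ), fun σ hσ hσ2 T hT => ?_⟩
  set κ : ℂ → ℂ := fun s => (max s.re 1 : ℝ) + (max s.im T₀ : ℝ) * I with hκ
  have hκc : Continuous κ := by fun_prop
  have hκid (s : ℂ) (h1 : 1 ≤ s.re) (h2 : T₀ ≤ s.im) : κ s = s := by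
    simp [hκ, max_eq_left h1, max_eq_left h2]
  have hκre (s : ℂ) : 1 ≤ (κ s).re := by simp [hκ]
  have hκim (s : ℂ) : T₀ ≤ (κ s).im := by simp [hκ]
  set g : ℂ → ℂ := fun s => f (κ s) with hg
  have hgc : Continuous g := continuous_iff_continuousAt.2 fun s =>
    (hd _ (hκre s) (hκim s)).continuousAt.comp hκc.continuousAt
  have hgne (s : ℂ) : g s ≠ 0 := hne _ (hκre s) (hκim s)
  set W : Set ℂ := {s | 1 < s.re ∧ T₀ < s.im} with hWdef
  have hW : IsOpen W := (isOpen_lt continuous_const continuous_re).inter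
    (isOpen_lt continuous_const continuous_im)
  have hgW : DifferentiableOn ℂ g W := by
    refine DifferentiableOn.congr (f := f) (fun s hs => (hd s hs.1.le hs.2.le).differentiableWithinAt)
      fun s hs => ?_
    simp only [hg, hκid s hs.1.le hs.2.le]
  set φ : ℝ → ℂ := fun u => (‖g (σ + (T + u : ℝ) * I)‖ : ℂ) / g (σ + (T + u : ℝ) * I) with hφ
  have hφc : Continuous φ := by
    refine Continuous.div (by fun_prop) (by fun_prop) fun u => hgne _
  have hφ1 u : ‖φ u‖ ≤ 1 := by
    simp only [hφ, norm_div, norm_real, norm_norm]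
    exact div_self_le_one _
  set G : ℂ → ℂ := fun s => ∫ u in (0 : ℝ)..δ, g (s + u * I) * φ u with hG
  have hGc : Continuous G :=
    intervalIntegral.continuous_parametric_intervalIntegral_of_continuous'
      (by fun_prop) _ _
  have hGle (s : ℂ) : ‖G s‖ ≤ ∫ u in (0 : ℝ)..δ, ‖g (s + u * I)‖ := by
    refine (intervalIntegral.norm_integral_le_integral_norm hδ.le).trans
      (intervalIntegral.integral_mono_on hδ.le
        ((by fun_prop : Continuous _).intervalIntegrable _ _)
        ((by fun_prop : Continuous _).intervalIntegrable _ _) fun u _ => ?_)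
    rw [norm_mul]
    exact mul_le_of_le_one_right (norm_nonneg _) (hφ1 u)
  have hGconst {s : ℂ} {A : ℝ} (h : ∀ u ∈ Set.Icc 0 δ, ‖g (s + u * I)‖ ≤ A) : ‖G s‖ ≤ A * δ := by
    refine (hGle s).trans ((intervalIntegral.integral_mono_on hδ.le
        ((by fun_prop : Continuous _).intervalIntegrable _ _) (by simp) h).trans ?_)
    simp [mul_comm]
  have hgf {s : ℂ} (h1 : 1 ≤ s.re) (h2 : T₀ ≤ s.im) {u : ℝ} (hu : 0 ≤ u) :
      g (s + u * I) = f (s + u * I) := by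
    simp only [hg]
    rw [hκid _ (by simpa using h1) (by simp; linarith)]
  have hmain : ‖G (σ + T * I)‖ ≤ max (max (C₁ * δ) C₂) (M * δ) := by
    refine norm_le_of_half_strip (T₀ := T₀) hGc (fun s h1 h2 => ?_) (fun s h1 h2 => ?_)
      (fun s h1 h2 h3 => ?_) (fun s h1 h2 h3 => ?_) (by simpa using hσ) (by simpa using hσ2)
      (by simpa using hT)
    · refine differentiableAt_integral_add_mul_I hW hgW hgc hφc hφ1 hδ.le ?_ ⟨h1, h2⟩
      rintro s ⟨hs1, hs2⟩ u ⟨hu, -⟩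
      exact ⟨by simpa using hs1, by simp; linarith⟩
    · refine le_trans (hGle s) (le_trans ?_ ((le_max_right _ _).trans (le_max_left _ _)))
      refine le_of_eq_of_le ?_ (hl s.im h2)
      have hsub := intervalIntegral.integral_comp_add_left (a := 0) (b := δ)
        (fun t : ℝ => ‖f (1 + t * I)‖) s.im
      rw [add_zero] at hsub
      rw [← hsub]
      refine intervalIntegral.integral_congr fun u hu => ?_
      rw [Set.uIcc_of_le hδ.le] at hu
      rw [hgf h1.ge h2 hu.1]
      congr 2
      apply Complex.ext <;> simp [h1]
    · refine le_trans (hGconst fun u hu => ?_) (le_max_right _ _)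
      rw [hgf h1 h3.ge hu.1]
      exact hM _ ⟨⟨by simpa using h1, by simpa using h2⟩, by simp [h3, hu.1], by simp [h3, hu.2]⟩
    · refine le_trans ?_ ((le_max_left _ _).trans (le_max_left _ _))
      have hs : 0 < s.re - 1 := by linarith
      have := hGconst (s := s) (A := C₁ / (s.re - 1)) fun u hu => by
        rw [hgf h1.le h3 hu.1, le_div_iff₀ hs]
        simpa using hb (s + u * I) (by simpa using h1) (by simpa using h2)
          (by simp; linarith [hu.1])
      calc ‖G s‖ * (s.re - 1) ≤ C₁ / (s.re - 1) * δ * (s.re - 1) :=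
            mul_le_mul_of_nonneg_right this hs.le
        _ = C₁ * δ := by field_simp
  refine le_of_eq_of_le ?_ ((re_le_norm _).trans hmain)
  have hGval : G (σ + T * I) = ((∫ t in (0 : ℝ)..δ, ‖f (σ + (T + t : ℝ) * I)‖ : ℝ) : ℂ) := by
    rw [← intervalIntegral.integral_ofReal]
    refine intervalIntegral.integral_congr fun u hu => ?_
    rw [Set.uIcc_of_le hδ.le] at hu
    have hpt : (σ : ℂ) + T * I + u * I = σ + (T + u : ℝ) * I := by
      push_cast
      ring
    have hfg := hgf (s := σ + T * I) (by simpa using hσ.le) (by simpa using hT.le) hu.1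
    simp only [hφ]
    rw [hpt] at hfg ⊢
    rw [mul_div_cancel₀ _ (hgne _), hfg]
  rw [hGval, ofReal_re]

lemma tendsto_mean_cexp {a : ℝ} (ha : a ≠ 0) :
    Tendsto (fun X : ℝ => (X : ℂ)⁻¹ * ∫ t in (0 : ℝ)..X, cexp (a * I * t)) atTop (nhds 0) := by
  have haI : (a : ℂ) * I ≠ 0 := by simpa using ha
  have hb : ∀ X : ℝ, ‖∫ t in (0 : ℝ)..X, cexp (a * I * t)‖ ≤ 2 / |a| := fun X => by
    rw [integral_exp_mul_complex haI, norm_div]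
    have h1 (t : ℝ) : ‖cexp (a * I * t)‖ = 1 := by
      rw [show (a : ℂ) * I * t = (a * t : ℝ) * I by push_cast; ring, norm_exp_ofReal_mul_I]
    rw [show ‖(a : ℂ) * I‖ = |a| by simp]
    refine div_le_div_of_nonneg_right ((norm_sub_le _ _).trans ?_) (abs_nonneg _)
    rw [h1, h1]
    norm_num
  have h0 : Tendsto (fun X : ℝ => X⁻¹ * (2 / |a|)) atTop (nhds 0) := by
    simpa using tendsto_inv_atTop_zero.mul_const (2 / |a|)
  refine squeeze_zero_norm' ?_ h0
  filter_upwards [eventually_gt_atTop 0] with X hX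
  rw [norm_mul, norm_inv, norm_real, Real.norm_of_nonneg hX.le]
  exact mul_le_mul_of_nonneg_left (hb X) (by positivity)

section Kronecker

/-- The linear flow on the torus with frequency vector `x`. -/
noncomputable def torusFlow {d : Type*} (x : d → ℝ) (t : ℝ) : UnitAddTorus d :=
  fun i => ((t * x i : ℝ) : UnitAddCircle)

lemma continuous_torusFlow {d : Type*} (x : d → ℝ) : Continuous (torusFlow x) :=
  continuous_pi fun i => (AddCircle.continuous_mk' (1 : ℝ)).comp (by fun_prop)

variable {d : Type*} [Fintype d]

/-- The Haar probability measure on the torus. -/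
noncomputable def torusHaar (d : Type*) [Fintype d] : Measure (UnitAddTorus d) :=
  Measure.pi fun _ => (AddCircle.haarAddCircle : Measure (AddCircle (1 : ℝ)))

instance : IsProbabilityMeasure (torusHaar d) := by unfold torusHaar; infer_instance

instance : (torusHaar d).IsOpenPosMeasure := by unfold torusHaar; infer_instance

lemma integral_mFourier {n : d → ℤ} (hn : n ≠ 0) :
    ∫ y, UnitAddTorus.mFourier n y ∂torusHaar d = 0 := by
  obtain ⟨i, hi⟩ := Function.ne_iff.1 hn
  have := MeasureTheory.integral_fintype_prod_eq_prod (𝕜 := ℂ)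
    (f := fun i (y : AddCircle (1 : ℝ)) => fourier (n i) y)
    (μ := fun _ : d => (AddCircle.haarAddCircle : Measure (AddCircle (1 : ℝ))))
  refine Eq.trans this (Finset.prod_eq_zero (Finset.mem_univ i) ?_)
  exact integral_eq_zero_of_add_right_eq_neg (μ := AddCircle.haarAddCircle)
      (fourier_add_half_inv_index hi one_pos)

lemma mFourier_torusFlow (x : d → ℝ) (n : d → ℤ) (t : ℝ) :
    UnitAddTorus.mFourier n (torusFlow x t) =
      cexp ((2 * π * ∑ i, n i * x i : ℝ) * I * t) := by
  simp only [UnitAddTorus.mFourier, ContinuousMap.coe_mk, torusFlow, fourier_coe_apply,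
    ← Complex.exp_sum]
  congr 1
  push_cast
  rw [Finset.mul_sum, Finset.sum_mul, Finset.sum_mul]
  refine Finset.sum_congr rfl fun i _ => ?_
  ring

lemma tendsto_mean_torusFlow {x : d → ℝ} (hx : ∀ n : d → ℤ, n ≠ 0 → ∑ i, n i * x i ≠ 0)
    (f : C(UnitAddTorus d, ℂ)) :
    Tendsto (fun X : ℝ => (X : ℂ)⁻¹ * ∫ t in (0 : ℝ)..X, f (torusFlow x t)) atTop
      (nhds (∫ y, f y ∂torusHaar d)) := by
  have hint (g : C(UnitAddTorus d, ℂ)) (a b : ℝ) :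
      IntervalIntegrable (fun t => g (torusFlow x t)) volume a b :=
    (g.continuous.comp (continuous_torusFlow x)).intervalIntegrable _ _
  have hint' (g : C(UnitAddTorus d, ℂ)) : Integrable g (torusHaar d) :=
    g.continuous.integrable_of_hasCompactSupport (HasCompactSupport.of_compactSpace _)
  have hspan : ∀ g ∈ Submodule.span ℂ (Set.range (UnitAddTorus.mFourier (d := d))),
      Tendsto (fun X : ℝ => (X : ℂ)⁻¹ * ∫ t in (0 : ℝ)..X, g (torusFlow x t)) atTop
        (nhds (∫ y, g y ∂torusHaar d)) := by
    intro g hg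
    induction hg using Submodule.span_induction with
    | mem g hg =>
      obtain ⟨n, rfl⟩ := hg
      by_cases hn : n = 0
      · subst hn
        refine tendsto_const_nhds.congr' ?_
        filter_upwards [eventually_ne_atTop 0] with X hX
        have : (X : ℂ) ≠ 0 := by exact_mod_cast hX
        simp [UnitAddTorus.mFourier_zero, this]
      · rw [integral_mFourier hn]
        simp only [mFourier_torusFlow]
        exact tendsto_mean_cexp (mul_ne_zero (by positivity) (hx n hn))
    | zero => simp
    | add g h _ _ hg hh =>
      simp only [ContinuousMap.add_apply]
      rw [integral_add (hint' g) (hint' h)]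
      refine (hg.add hh).congr fun X => ?_
      rw [intervalIntegral.integral_add (hint g _ _) (hint h _ _), mul_add]
    | smul c g _ hg =>
      simp only [ContinuousMap.smul_apply, smul_eq_mul]
      rw [MeasureTheory.integral_const_mul]
      refine (hg.const_mul c).congr fun X => ?_
      rw [intervalIntegral.integral_const_mul]
      ring
  rw [Metric.tendsto_atTop]
  intro ε hε
  have hcl : f ∈ (Submodule.span ℂ
      (Set.range (UnitAddTorus.mFourier (d := d)))).topologicalClosure := by
    rw [UnitAddTorus.span_mFourier_closure_eq_top]
    trivial
  obtain ⟨g, hg, hfg⟩ := Metric.mem_closure_iff.1 hcl (ε / 3) (by positivity)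
  obtain ⟨N, hN⟩ := Metric.tendsto_atTop.1 (hspan g hg) (ε / 3) (by positivity)
  refine ⟨max N 1, fun X hX => ?_⟩
  have hX0 : 0 < X := lt_of_lt_of_le one_pos ((le_max_right _ _).trans hX)
  have hpt (y : UnitAddTorus d) : ‖f y - g y‖ ≤ ε / 3 := by
    rw [← dist_eq_norm]
    exact (ContinuousMap.dist_apply_le_dist y).trans hfg.le
  have h1 : dist ((X : ℂ)⁻¹ * ∫ t in (0 : ℝ)..X, f (torusFlow x t))
      ((X : ℂ)⁻¹ * ∫ t in (0 : ℝ)..X, g (torusFlow x t)) ≤ ε / 3 := by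
    rw [dist_eq_norm, ← mul_sub, ← intervalIntegral.integral_sub (hint f _ _) (hint g _ _),
      norm_mul, norm_inv, norm_real, Real.norm_of_nonneg hX0.le, inv_mul_le_iff₀ hX0]
    refine (intervalIntegral.norm_integral_le_of_norm_le_const fun t _ => hpt _).trans ?_
    rw [sub_zero, abs_of_pos hX0, mul_comm]
  have h2 := hN X ((le_max_left _ _).trans hX)
  have h3 : dist (∫ y, g y ∂torusHaar d) (∫ y, f y ∂torusHaar d) ≤ ε / 3 := by
    rw [dist_comm, dist_eq_norm, ← integral_sub (hint' f) (hint' g)]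
    exact (norm_integral_le_of_norm_le_const (.of_forall hpt)).trans (by simp)
  linarith [dist_triangle4 ((X : ℂ)⁻¹ * ∫ t in (0 : ℝ)..X, f (torusFlow x t))
    ((X : ℂ)⁻¹ * ∫ t in (0 : ℝ)..X, g (torusFlow x t)) (∫ y, g y ∂torusHaar d)
    (∫ y, f y ∂torusHaar d)]

/-- Kronecker's theorem for linear flows on the torus. -/
lemma exists_ge_torusFlow_mem {x : d → ℝ} (hx : ∀ n : d → ℤ, n ≠ 0 → ∑ i, n i * x i ≠ 0)
    {U : Set (UnitAddTorus d)} (hU : IsOpen U) (hne : U.Nonempty) (T₀ : ℝ) :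
    ∃ T, T₀ ≤ T ∧ torusFlow x T ∈ U := by
  by_contra! hcon
  obtain ⟨y, hy⟩ := hne
  obtain ⟨f, hf0, hf1, hf⟩ := exists_continuous_zero_one_of_isClosed hU.isClosed_compl
    isClosed_singleton (Set.disjoint_singleton_right.2 (by simpa using hy))
  let F : C(UnitAddTorus d, ℂ) := ⟨fun z => f z, by fun_prop⟩
  have hpos : 0 < ∫ z, f z ∂torusHaar d :=
    f.continuous.integral_pos_of_hasCompactSupport_nonneg_nonzero
      (HasCompactSupport.of_compactSpace _) (fun z => (hf z).1)
      (x := y) (by rw [hf1 rfl]; simp)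
  have hlim := tendsto_mean_torusFlow hx F
  have hlim0 : Tendsto (fun X : ℝ => (X : ℂ)⁻¹ * ∫ t in (0 : ℝ)..X, F (torusFlow x t)) atTop
      (nhds 0) := by
    have hz : Tendsto (fun X : ℝ => (X : ℂ)⁻¹ * ∫ t in (0 : ℝ)..T₀, F (torusFlow x t)) atTop
        (nhds 0) := by
      have : Tendsto (fun X : ℝ => (X : ℂ)⁻¹) atTop (nhds 0) := by
        simpa [Function.comp_def] using (continuous_ofReal.tendsto (0 : ℝ)).comp tendsto_inv_atTop_zero
      simpa using this.mul_const _
    refine hz.congr' ?_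
    filter_upwards [eventually_ge_atTop T₀] with X hX
    have hint (a b : ℝ) : IntervalIntegrable (fun t => F (torusFlow x t)) volume a b :=
      (F.continuous.comp (continuous_torusFlow x)).intervalIntegrable _ _
    rw [← intervalIntegral.integral_add_adjacent_intervals (hint 0 T₀) (hint T₀ X)]
    have : ∫ t in T₀..X, F (torusFlow x t) = ∫ t in T₀..X, (0 : ℂ) := by
      refine intervalIntegral.integral_congr fun t ht => ?_
      rw [Set.uIcc_of_le hX] at ht
      have := hf0 (hcon t ht.1)
      simpa [F] using this
    rw [this]
    simp
  have heq := tendsto_nhds_unique hlim hlim0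
  have : ∫ z, F z ∂torusHaar d = ((∫ z, f z ∂torusHaar d : ℝ) : ℂ) := integral_ofReal
  rw [this] at heq
  exact hpos.ne' (by exact_mod_cast heq)

end Kronecker

lemma padicValRat_finset_prod {ι : Type*} (q : ℕ) [Fact q.Prime] (s : Finset ι) {f : ι → ℚ}
    (hf : ∀ i ∈ s, f i ≠ 0) : padicValRat q (∏ i ∈ s, f i) = ∑ i ∈ s, padicValRat q (f i) := by
  classical
  induction s using Finset.induction_on with
  | empty => simp
  | insert a s ha ih =>
    rw [Finset.forall_mem_insert] at hf
    rw [Finset.prod_insert ha, Finset.sum_insert ha,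
      padicValRat.mul hf.1 (Finset.prod_ne_zero_iff.2 hf.2), ih hf.2]

lemma sum_int_mul_log_prime_ne_zero {S : Finset Nat.Primes} {n : S → ℤ} (hn : n ≠ 0) :
    ∑ i, (n i : ℝ) * Real.log ((i : Nat.Primes) : ℕ) ≠ 0 := by
  classical
  intro h
  refine hn (funext fun j => ?_)
  have hpos (i : S) : (0 : ℝ) < ((i : Nat.Primes) : ℕ) := by exact_mod_cast i.1.2.pos
  have hexp (i : S) : Real.exp ((n i : ℝ) * Real.log ((i : Nat.Primes) : ℕ)) =
      (((i : Nat.Primes) : ℕ) : ℝ) ^ n i := by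
    rw [mul_comm, ← Real.rpow_def_of_pos (hpos i), Real.rpow_intCast]
  have hprod : ∏ i : S, (((i : Nat.Primes) : ℕ) : ℚ) ^ n i = 1 := by
    have h1 : Real.exp (∑ i, (n i : ℝ) * Real.log ((i : Nat.Primes) : ℕ)) = 1 := by
      rw [h, Real.exp_zero]
    rw [Real.exp_sum, Finset.prod_congr rfl fun i _ => hexp i] at h1
    refine Rat.cast_injective (α := ℝ) ?_
    rw [Rat.cast_one, Rat.cast_prod, ← h1]
    simp
  have : Fact ((j : Nat.Primes) : ℕ).Prime := ⟨j.1.2⟩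
  have hval := congrArg (padicValRat ((j : Nat.Primes) : ℕ)) hprod
  have hne (i : S) : (((i : Nat.Primes) : ℕ) : ℚ) ≠ 0 := by exact_mod_cast i.1.2.ne_zero
  rw [padicValRat_finset_prod _ _ fun i _ => zpow_ne_zero _ (hne i), padicValRat.one,
    Finset.sum_eq_single j] at hval
  · simpa [padicValRat.zpow, padicValRat.self this.out.one_lt] using hval
  · intro i _ hij
    have : ¬ ((j : Nat.Primes) : ℕ) ∣ ((i : Nat.Primes) : ℕ) := fun hdvd =>
      hij (Subtype.ext (Subtype.ext ((Nat.prime_dvd_prime_iff_eq j.1.2 i.1.2).1 hdvd).symm))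
    rw [padicValRat.zpow, padicValRat.of_nat, padicValNat.eq_zero_of_not_dvd this]
    simp
  · simp

lemma exists_ge_norm_prime_twist_sub_lt (S : Finset Nat.Primes) (θ : ℝ) {η : ℝ} (hη : 0 < η)
    (T₀ : ℝ) : ∃ T, T₀ ≤ T ∧ ∀ p ∈ S, ‖cexp ((-Real.log p : ℝ) * T * I) - cexp (θ * I)‖ < η := by
  let x : S → ℝ := fun p => -Real.log ((p : Nat.Primes) : ℕ) / (2 * π)
  have hx (n : S → ℤ) (hn : n ≠ 0) : ∑ i, n i * x i ≠ 0 := by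
    have : ∑ i, n i * x i =
        -(∑ i, (n i : ℝ) * Real.log ((i : Nat.Primes) : ℕ)) / (2 * π) := by
      rw [← Finset.sum_neg_distrib, Finset.sum_div]
      exact Finset.sum_congr rfl fun i _ => by simp only [x]; ring
    rw [this]
    exact div_ne_zero (neg_ne_zero.2 (sum_int_mul_log_prime_ne_zero hn)) (by positivity)
  let V : S → Set (UnitAddTorus S) := fun i => {y | ‖fourier 1 (y i) - cexp (θ * I)‖ < η}
  have hV : IsOpen (⋂ i, V i) := isOpen_iInter_of_finite fun i =>
    isOpen_lt (by fun_prop) continuous_const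
  have hne : (⋂ i, V i).Nonempty := by
    refine ⟨fun _ => ((θ / (2 * π) : ℝ) : UnitAddCircle), Set.mem_iInter.2 fun i => ?_⟩
    have h : fourier 1 ((θ / (2 * π) : ℝ) : UnitAddCircle) = cexp (θ * I) := by
      rw [fourier_coe_apply]
      congr 1
      push_cast
      have : (π : ℂ) ≠ 0 := by exact_mod_cast Real.pi_ne_zero
      field_simp
    change ‖fourier 1 ((θ / (2 * π) : ℝ) : UnitAddCircle) - cexp (θ * I)‖ < η
    rwa [h, sub_self, norm_zero]
  obtain ⟨T, hT, hmem⟩ := exists_ge_torusFlow_mem hx hV hne T₀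
  refine ⟨T, hT, fun p hp => ?_⟩
  have h := Set.mem_iInter.1 hmem ⟨p, hp⟩
  simp only [V, torusFlow, Set.mem_ofPred_eq, fourier_coe_apply, x] at h
  convert h using 4
  push_cast
  have : (π : ℂ) ≠ 0 := by exact_mod_cast Real.pi_ne_zero
  field_simp

lemma exists_seq_tendsto_prime_twist (θ : ℝ) : ∃ T : ℕ → ℝ, Tendsto T atTop atTop ∧
    ∀ p : Nat.Primes, Tendsto (fun n => cexp ((-Real.log p : ℝ) * T n * I)) atTop
      (nhds (cexp (θ * I))) := by
  choose T hT hTp using fun n : ℕ => exists_ge_norm_prime_twist_sub_lt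
    ((Finset.range n).subtype Nat.Prime) θ (η := 1 / (n + 1)) (by positivity) n
  refine ⟨T, tendsto_atTop_mono hT tendsto_natCast_atTop_atTop, fun p => ?_⟩
  rw [tendsto_iff_norm_sub_tendsto_zero]
  refine squeeze_zero' (.of_forall fun n => norm_nonneg _) ?_ tendsto_one_div_add_atTop_nhds_zero_nat
  filter_upwards [eventually_gt_atTop (p : ℕ)] with n hn
  exact (hTp n p (Finset.mem_subtype.2 (Finset.mem_range.2 hn))).le

lemma tendsto_logEulerZeta_of_tendsto_twist {T : ℕ → ℝ} {u : ℂ}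
    (hT : ∀ p : Nat.Primes, Tendsto (fun n => cexp ((-Real.log p : ℝ) * T n * I)) atTop (nhds u))
    {σ : ℝ} (hσ : 1 < σ) (t : ℝ) :
    Tendsto (fun n => logEulerZeta (σ + (T n + t : ℝ) * I)) atTop
      (nhds (∑' p : Nat.Primes, -Complex.log (1 - u * (p : ℂ) ^ (-(σ + t * I))))) := by
  have hnorm (p : Nat.Primes) (τ : ℝ) : ‖(p : ℂ) ^ (-((σ : ℂ) + τ * I))‖ = (p : ℝ) ^ (-σ) := by
    rw [norm_prime_cpow_neg]
    simp
  have hsplit (p : Nat.Primes) (n : ℕ) : (p : ℂ) ^ (-((σ : ℂ) + (T n + t : ℝ) * I)) =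
      cexp ((-Real.log p : ℝ) * T n * I) * (p : ℂ) ^ (-((σ : ℂ) + t * I)) := by
    rw [prime_cpow_neg, prime_cpow_neg, mul_left_comm, ← Complex.exp_add]
    push_cast
    ring_nf
  have hu (p : Nat.Primes) : Tendsto (fun n => (p : ℂ) ^ (-((σ : ℂ) + (T n + t : ℝ) * I))) atTop
      (nhds (u * (p : ℂ) ^ (-((σ : ℂ) + t * I)))) := by
    simp only [hsplit]
    exact (hT p).mul_const _
  refine tendsto_tsum_of_dominated_convergence
    (bound := fun p : Nat.Primes => 3 / 2 * (p : ℝ) ^ (-σ))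
    ((summable_primes_rpow_neg hσ).mul_left _) (fun p => ?_) (.of_forall fun n p => ?_)
  · have hle : ‖u * (p : ℂ) ^ (-((σ : ℂ) + t * I))‖ ≤ 1 / 2 :=
      le_of_tendsto' (hu p).norm fun n => (hnorm _ _).trans_le (prime_rpow_neg_le_half p hσ)
    refine ((tendsto_const_nhds.sub (hu p)).clog ?_).neg
    rw [sub_eq_add_neg]
    exact mem_slitPlane_of_norm_lt_one (by rw [norm_neg]; linarith)
  · rw [← hnorm p (T n + t)]
    exact norm_log_one_sub_le ((hnorm _ _).trans_le (prime_rpow_neg_le_half p hσ))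

lemma log_one_add_add_log_one_sub {z : ℂ} (hz : ‖z‖ < 1) :
    Complex.log (1 + z) + Complex.log (1 - z) = Complex.log (1 - z ^ 2) := by
  have h1 : 0 < (1 + z).re := by
    have := (abs_le.1 (abs_re_le_norm z)).1
    simp only [add_re, one_re]
    linarith
  have h2 : 0 < (1 - z).re := by
    have := (abs_le.1 (abs_re_le_norm z)).2
    simp only [sub_re, one_re]
    linarith
  have a1 := abs_lt.1 (abs_arg_lt_pi_div_two_iff.2 (.inl h1))
  have a2 := abs_lt.1 (abs_arg_lt_pi_div_two_iff.2 (.inl h2))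
  rw [← Complex.log_mul (fun h => by simp [h] at h1) (fun h => by simp [h] at h2)
    ⟨by linarith, by linarith⟩]
  ring_nf

lemma tsum_log_one_add_add_logEulerZeta {s : ℂ} (hs : 1 < s.re) :
    (∑' p : Nat.Primes, -Complex.log (1 + (p : ℂ) ^ (-s))) + logEulerZeta s =
      logEulerZeta (2 * s) := by
  have hle (p : Nat.Primes) : ‖(p : ℂ) ^ (-s)‖ ≤ 1 / 2 :=
    (norm_prime_cpow_neg p s).trans_le (prime_rpow_neg_le_half p hs)
  have hsum : Summable fun p : Nat.Primes => -Complex.log (1 + (p : ℂ) ^ (-s)) := by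
    refine Summable.of_norm_bounded ((summable_primes_rpow_neg hs).mul_left (3 / 2)) fun p => ?_
    rw [← norm_prime_cpow_neg]
    simpa using norm_log_one_sub_le (z := -(p : ℂ) ^ (-s)) (by simpa using hle p)
  rw [logEulerZeta, logEulerZeta, ← hsum.tsum_add (summable_logEulerZeta hs)]
  refine tsum_congr fun p => ?_
  rw [← neg_add, log_one_add_add_log_one_sub ((hle p).trans_lt (by norm_num)),
    show -(2 * s) = -s * (2 : ℕ) by push_cast; ring, cpow_mul_nat]

lemma norm_zeta_zpow_le {k : ℤ} (hk : k = 1 ∨ k = -1) {σ : ℝ} (hσ : 1 < σ) (t : ℝ) :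
    ‖riemannZeta (σ + t * I) ^ k‖ ≤ ‖riemannZeta σ‖ := by
  have hk' : ‖(k : ℂ)‖ ≤ 1 := by rcases hk with rfl | rfl <;> simp
  have h := (majorized_mul_logEulerZeta hσ hk').exp.norm_le t
  rw [← exp_logEulerZeta (by simpa using hσ), ← Complex.exp_int_mul]
  simpa [exp_logEulerZeta (s := (σ : ℂ)) (by simpa using hσ)] using h

lemma exists_le_norm_cexp_twisted {k : ℤ} (hk : k = 1 ∨ k = -1) :
    ∃ c > 0, ∀ σ t : ℝ, 1 < σ → σ < 2 → c * ‖riemannZeta (σ + t * I)‖ ≤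
      ‖cexp (∑' p : Nat.Primes, -Complex.log (1 - k * (p : ℂ) ^ (-(σ + t * I)))) ^ k‖ := by
  rcases hk with rfl | rfl
  · refine ⟨1, one_pos, fun σ t hσ _ => ?_⟩
    rw [one_mul, ← exp_logEulerZeta (by simpa using hσ)]
    simp [logEulerZeta]
  · have hc : ContinuousOn (fun σ : ℝ => ‖riemannZeta (2 * σ : ℝ)‖) (Set.Icc 1 2) := by
      refine fun σ hσ => ContinuousAt.continuousWithinAt ?_
      have h1 : ((2 * σ : ℝ) : ℂ) ≠ 1 := by
        norm_cast
        have := hσ.1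
        intro h
        linarith
      exact ((differentiableAt_riemannZeta h1).continuousAt.comp
        (f := fun σ : ℝ => ((2 * σ : ℝ) : ℂ)) (by fun_prop)).norm
    obtain ⟨M, hM⟩ := (isCompact_Icc.image_of_continuousOn hc).bddAbove
    refine ⟨(max M 1)⁻¹, by positivity, fun σ t hσ hσ2 => ?_⟩
    have hs : 1 < ((σ : ℂ) + t * I).re := by simpa using hσ
    have hs2 : 1 < (2 * ((σ : ℂ) + t * I)).re := by
      simp only [mul_re, re_ofNat, im_ofNat, zero_mul, sub_zero]
      linarith
    have hle : ‖riemannZeta (2 * ((σ : ℂ) + t * I))‖ ≤ max M 1 := by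
      have h := norm_zeta_zpow_le (.inl rfl) (show 1 < 2 * σ by linarith) (2 * t)
      rw [zpow_one] at h
      have harg : 2 * ((σ : ℂ) + t * I) = (2 * σ : ℝ) + (2 * t : ℝ) * I := by
        push_cast
        ring
      rw [harg]
      exact h.trans ((hM ⟨σ, ⟨hσ.le, hσ2.le⟩, rfl⟩).trans (le_max_left M 1))
    have heq := congrArg cexp (tsum_log_one_add_add_logEulerZeta hs)
    rw [Complex.exp_add, exp_logEulerZeta hs, exp_logEulerZeta hs2] at heq
    rw [← heq, norm_mul] at hle
    have hpos : 0 < ‖cexp (∑' p : Nat.Primes, -Complex.log (1 + (p : ℂ) ^ (-(σ + t * I))))‖ :=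
      norm_pos_iff.2 (Complex.exp_ne_zero _)
    simp only [Int.reduceNeg, Int.cast_neg, Int.cast_one, neg_one_mul, sub_neg_eq_add, zpow_neg,
      zpow_one, norm_inv]
    rw [inv_mul_le_iff₀ (by positivity), ← div_eq_mul_inv, le_div_iff₀ hpos]
    linarith

lemma exists_lt_mul_integral_inv {c δ : ℝ} (hc : 0 < c) (hδ : 0 < δ) (C : ℝ) :
    ∃ a > 0, a < 1 ∧ C < c * ∫ t in (0 : ℝ)..δ, (a + t)⁻¹ := by
  have ha : 0 < min (1 / 2) (δ * Real.exp (-((|C| + 1) / c))) := by positivity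
  refine ⟨_, ha, (min_le_left _ _).trans_lt (by norm_num), ?_⟩
  set a := min (1 / 2) (δ * Real.exp (-((|C| + 1) / c))) with ha'
  have hle : a * Real.exp ((|C| + 1) / c) ≤ δ := by
    refine (mul_le_mul_of_nonneg_right (min_le_right _ _) (Real.exp_pos _).le).trans_eq ?_
    rw [mul_assoc, ← Real.exp_add, neg_add_cancel, Real.exp_zero, mul_one]
  rw [intervalIntegral.integral_comp_add_left (fun t => t⁻¹), add_zero,
    integral_inv_of_pos ha (by positivity)]
  have hlog : (|C| + 1) / c ≤ Real.log ((a + δ) / a) := by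
    rw [Real.le_log_iff_exp_le (by positivity), le_div_iff₀ ha]
    linarith
  calc C < |C| + 1 := (le_abs_self C).trans_lt (lt_add_one _)
    _ = c * ((|C| + 1) / c) := by field_simp
    _ ≤ _ := mul_le_mul_of_nonneg_left hlog hc.le

lemma not_forall_integral_zeta_zpow_le {k : ℤ} (hk : k = 1 ∨ k = -1) {δ : ℝ} (hδ : 0 < δ)
    (T₀ C : ℝ) : ¬ ∀ σ : ℝ, 1 < σ → σ < 2 → ∀ T, T₀ < T →
      ∫ t in (0 : ℝ)..δ, ‖riemannZeta (σ + (T + t : ℝ) * I) ^ k‖ ≤ C := by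
  intro h
  obtain ⟨θ, hθ⟩ : ∃ θ : ℝ, cexp (θ * I) = k := by
    rcases hk with rfl | rfl
    · exact ⟨0, by simp⟩
    · exact ⟨π, by simp⟩
  obtain ⟨T, hT, hTp⟩ := exists_seq_tendsto_prime_twist θ
  rw [hθ] at hTp
  obtain ⟨c₁, hc₁, hc⟩ := exists_le_norm_cexp_twisted hk
  obtain ⟨c₂, hc₂, _, hR⟩ := exists_residue_bounds δ
  obtain ⟨a, ha, ha1, hlt⟩ := exists_lt_mul_integral_inv (mul_pos hc₁ hc₂) hδ C
  have hσ : 1 < 1 + a := by linarith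
  let F : ℕ → ℝ → ℝ := fun n t => ‖riemannZeta ((1 + a : ℝ) + (T n + t : ℝ) * I) ^ k‖
  let L : ℝ → ℝ := fun t =>
    ‖cexp (∑' p : Nat.Primes, -Complex.log (1 - k * (p : ℂ) ^ (-((1 + a : ℝ) + t * I)))) ^ k‖
  have hF (n : ℕ) : Continuous (F n) := by
    refine continuous_iff_continuousAt.2 fun t => ?_
    have h1 : ((1 + a : ℝ) : ℂ) + (T n + t : ℝ) * I ≠ 1 := fun h => by
      simpa [ha.ne'] using congrArg re h
    have h2 : riemannZeta ((1 + a : ℝ) + (T n + t : ℝ) * I) ≠ 0 :=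
      riemannZeta_ne_zero_of_one_le_re (by simpa using ha.le)
    exact (((differentiableAt_riemannZeta h1).continuousAt.comp
      (f := fun t : ℝ => ((1 + a : ℝ) : ℂ) + (T n + t : ℝ) * I) (by fun_prop)).zpow₀ k
        (.inl h2)).norm
  have hFL (t : ℝ) : Tendsto (fun n => F n t) atTop (nhds (L t)) := by
    have := ((Complex.continuous_exp.tendsto _).comp
      (tendsto_logEulerZeta_of_tendsto_twist hTp hσ t)).zpow₀ k (.inl (Complex.exp_ne_zero _))
    refine this.norm.congr fun n => ?_
    rw [Function.comp_apply, exp_logEulerZeta (by simpa using ha)]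
  have hFle (n : ℕ) (t : ℝ) : F n t ≤ ‖riemannZeta (1 + a : ℝ)‖ := norm_zeta_zpow_le hk hσ _
  have hLi : IntervalIntegrable L volume 0 δ := by
    refine (intervalIntegrable_const (c := ‖riemannZeta (1 + a : ℝ)‖)).mono_fun ?_
      (.of_forall fun t => ?_)
    · exact (measurable_of_tendsto_metrizable (fun n => (hF n).measurable)
        (tendsto_pi_nhds.2 hFL)).aestronglyMeasurable
    · rw [norm_norm]
      exact (le_of_tendsto' (hFL t) fun n => hFle n t).trans_eq' (by simp [L])
  have hLC : ∫ t in (0 : ℝ)..δ, L t ≤ C := by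
    have hlim : Tendsto (fun n => ∫ t in (0 : ℝ)..δ, F n t) atTop
        (nhds (∫ t in (0 : ℝ)..δ, L t)) := by
      refine intervalIntegral.tendsto_integral_filter_of_dominated_convergence
        (fun _ => ‖riemannZeta (1 + a : ℝ)‖) (.of_forall fun n => (hF n).aestronglyMeasurable)
        (.of_forall fun n => .of_forall fun t _ => ?_) intervalIntegrable_const
        (.of_forall fun t _ => hFL t)
      rw [Real.norm_of_nonneg (norm_nonneg _)]
      exact hFle n t
    refine le_of_tendsto hlim ?_
    filter_upwards [hT.eventually_gt_atTop T₀] with n hn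
    exact h (1 + a) hσ (by linarith) (T n) hn
  refine hlt.not_ge (le_trans ?_ hLC)
  rw [← intervalIntegral.integral_const_mul]
  refine intervalIntegral.integral_mono_on hδ.le ?_ hLi fun t ht => ?_
  · refine ContinuousOn.intervalIntegrable fun t ht => ?_
    rw [Set.uIcc_of_le hδ.le] at ht
    have : a + t ≠ 0 := by linarith [ht.1]
    exact ContinuousAt.continuousWithinAt (by fun_prop (disch := assumption))
  · refine le_trans ?_ (hc (1 + a) t hσ (by linarith))
    rw [mul_assoc]
    refine mul_le_mul_of_nonneg_left ?_ hc₁.le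
    set s : ℂ := (1 + a : ℝ) + t * I with hs
    have hat : 0 < a + t := by linarith [ht.1]
    have hs1 : s ≠ 1 := fun h => by simpa [hs, ha.ne'] using congrArg re h
    have hres := (hR s (by simpa [hs] using ha.le) (by simp [hs]; linarith)
      (by simpa [hs, abs_of_nonneg ht.1] using ht.2) hs1).1
    have hle : ‖s - 1‖ ≤ a + t := by
      have : s - 1 = (a : ℂ) + t * I := by rw [hs]; push_cast; ring
      rw [this]
      refine (norm_add_le _ _).trans_eq ?_
      simp [abs_of_pos ha, abs_of_nonneg ht.1]
    rw [← div_eq_mul_inv, div_le_iff₀ hat, mul_comm]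
    exact hres.trans (mul_le_mul_of_nonneg_right hle (norm_nonneg _))

lemma zpow_sign_le_one_add_rpow {p : ℝ} (hp : p ≤ -1 ∨ 1 ≤ p) : ∃ k : ℤ, (k = 1 ∨ k = -1) ∧
    ∀ x : ℝ, 0 < x → x ^ k ≤ 1 + x ^ p := by
  have key {q x : ℝ} (hq : 1 ≤ q) (hx : 0 < x) : x ≤ 1 + x ^ q := by
    rcases le_total x 1 with h | h
    · linarith [Real.rpow_nonneg hx.le q]
    · linarith [Real.self_le_rpow_of_one_le h hq]
  rcases hp with hp | hp
  · refine ⟨-1, .inr rfl, fun x hx => ?_⟩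
    have := key (q := -p) (by linarith) (inv_pos.2 hx)
    rwa [Real.inv_rpow hx.le, Real.rpow_neg hx.le, inv_inv, ← zpow_neg_one] at this
  · exact ⟨1, .inl rfl, fun x hx => by simpa using key hp hx⟩

lemma not_forall_integral_zeta_one_rpow_le {p : ℝ} (hp : p ≤ -1 ∨ 1 ≤ p) {δ : ℝ} (hδ : 0 < δ)
    {T₀ : ℝ} (hT₀ : 1 ≤ T₀) (C : ℝ) :
    ¬ ∀ T : ℝ, T₀ ≤ T → ∫ t in T..(T + δ), ‖riemannZeta (1 + t * I)‖ ^ p ≤ C := by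
  intro h
  obtain ⟨k, hk, hkp⟩ := zpow_sign_le_one_add_rpow hp
  have hs1 (s : ℂ) (hs : T₀ ≤ s.im) : s ≠ 1 := fun h => by
    have := congrArg im h
    simp only [one_im] at this
    linarith
  have hs0 (s : ℂ) (hs : 1 ≤ s.re) : riemannZeta s ≠ 0 := riemannZeta_ne_zero_of_one_le_re hs
  have hcont (a b : ℝ) (ha : T₀ ≤ a) (hab : a ≤ b) :
      ContinuousOn (fun t : ℝ => ‖riemannZeta (1 + t * I)‖) (Set.uIcc a b) := by
    intro t ht
    rw [Set.uIcc_of_le hab] at ht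
    have h1 := hs1 (1 + t * I) (by simpa using ha.trans ht.1)
    exact ((differentiableAt_riemannZeta h1).continuousAt.comp
      (f := fun t : ℝ => 1 + (t : ℂ) * I) (by fun_prop)).norm.continuousWithinAt
  have hpos (t : ℝ) : 0 < ‖riemannZeta (1 + t * I)‖ := norm_pos_iff.2 (hs0 _ (by simp))
  obtain ⟨_, _, C₁, hC₁⟩ := exists_residue_bounds 0
  have hb (s : ℂ) (h1 : 1 < s.re) (h2 : s.re ≤ 2) :
      ‖riemannZeta s ^ k‖ * (s.re - 1) ≤ C₁ := by
    have hle := norm_zeta_zpow_le hk h1 s.im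
    rw [re_add_im] at hle
    have hres := (hC₁ s.re (by simpa using h1.le) (by simpa using h2) (by simp)
      (by exact_mod_cast h1.ne')).2
    have hn : ‖(s.re : ℂ) - 1‖ = s.re - 1 := by
      rw [← ofReal_one, ← ofReal_sub, norm_real, Real.norm_of_nonneg (by linarith)]
    rw [hn, mul_comm] at hres
    exact (mul_le_mul_of_nonneg_right hle (by linarith)).trans hres
  have hl (T : ℝ) (hT : T₀ ≤ T) :
      ∫ t in T..(T + δ), ‖riemannZeta (1 + t * I) ^ k‖ ≤ δ + C := by
    have hTδ : T ≤ T + δ := by linarith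
    have hi := hcont T (T + δ) hT hTδ
    have hip : IntervalIntegrable (fun t : ℝ => ‖riemannZeta (1 + t * I)‖ ^ p) volume T (T + δ) :=
      (hi.rpow_const fun t _ => .inl (hpos t).ne').intervalIntegrable
    have hik : IntervalIntegrable (fun t : ℝ => ‖riemannZeta (1 + t * I) ^ k‖) volume T (T + δ) := by
      simp only [norm_zpow]
      exact (hi.zpow₀ k fun t _ => .inl (hpos t).ne').intervalIntegrable
    calc ∫ t in T..(T + δ), ‖riemannZeta (1 + t * I) ^ k‖
        ≤ ∫ t in T..(T + δ), (1 + ‖riemannZeta (1 + t * I)‖ ^ p) := by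
          refine intervalIntegral.integral_mono_on hTδ hik
            (intervalIntegrable_const.add hip) fun t _ => ?_
          rw [norm_zpow]
          exact hkp _ (hpos t)
      _ = δ + ∫ t in T..(T + δ), ‖riemannZeta (1 + t * I)‖ ^ p := by
          rw [intervalIntegral.integral_add intervalIntegrable_const hip]
          simp
      _ ≤ δ + C := by linarith [h T hT]
  obtain ⟨C', hC'⟩ := exists_integral_norm_le_of_line (f := fun s => riemannZeta s ^ k) hδ
    (fun s h1 h2 => (differentiableAt_riemannZeta (hs1 s h2)).zpow (.inl (hs0 s h1)))
    (fun s h1 _ => zpow_ne_zero _ (hs0 s h1)) (fun s h1 h2 _ => hb s h1 h2) hl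
  exact not_forall_integral_zeta_zpow_le hk hδ T₀ C' hC'

theorem stmt_3 (δ : ℝ) (hδ : 0 < δ) (p : ℝ) :
    Filter.limsup (fun T : ℝ =>
        ((∫ t in T..(T + δ), ‖riemannZeta (1 + t * Complex.I)‖ ^ p : ℝ) : EReal))
      Filter.atTop < ⊤ ↔ (-1 < p ∧ p < 1) := by
  constructor
  · intro h
    by_contra hp
    have hp' : p ≤ -1 ∨ 1 ≤ p := by
      by_contra! h'
      exact hp h'
    obtain ⟨C, hC, -⟩ := EReal.lt_iff_exists_real_btwn.1 h
    obtain ⟨T₀, hT₀⟩ := eventually_atTop.1 (eventually_lt_of_limsup_lt hC)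
    exact not_forall_integral_zeta_one_rpow_le hp' hδ (le_max_right T₀ 1) C fun T hT =>
      EReal.coe_le_coe_iff.1 (hT₀ T ((le_max_left _ _).trans hT)).le
  · rintro ⟨h1, h2⟩
    obtain ⟨B, hB⟩ := exists_integral_zeta_one_rpow_le h1 h2 hδ
    refine lt_of_le_of_lt (limsup_le_of_le (a := (B : EReal)) (by isBoundedDefault) ?_)
      (EReal.coe_lt_top B)
    filter_upwards [eventually_ge_atTop 1] with T hT
    exact EReal.coe_le_coe_iff.2 (hB T hT)
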